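/- arXiv:1412.2192 — 4 statements merged into one kernel-verified Lean document; each statement's English description precedes it below -/
import Mathlib

section
/- Let F = (S, R, M) be an FVR with input length n such that for every type class T ∈ T_n and every M0 ∈ S, the number of sequences x^n ∈ T with M(x^n) = M0 and R(x^n) = r is the same for all r ∈ {0,…,M0−1} (in particular, the number of x^n ∈ T with M(x^n) = M0 is a multiple of M0). Then F is universal in P_k, i.e., F is perfect for every k-th order finite-memory process P. -/
open Finset

/-- Symbol at (0-indexed) integer position `j` of `x : Fin n → A`, where negative
positions `-k, …, -1` are given by the fixed initial state `s0`. -/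
def symAt {A : Type*} [Inhabited A] (k n : ℕ) (s0 : Fin k → A) (x : Fin n → A) (j : ℤ) : A :=
  if h : 0 ≤ j then
    (if h2 : j.toNat < n then x ⟨j.toNat, h2⟩ else default)
  else
    (if h3 : (j + k).toNat < k then s0 ⟨(j + k).toNat, h3⟩ else default)

/-- The state (context of order `k`) preceding position `t` of `x`. -/
def ctx {A : Type*} [Inhabited A] (k n : ℕ) (s0 : Fin k → A) (x : Fin n → A)
    (t : Fin n) : Fin k → A :=
  fun i => symAt k n s0 x ((t : ℤ) - (k : ℤ) + (i : ℤ))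

/-- Probability `P(x^n) = ∏_t p(x_t | x_{t-k}^{t-1})` of the sequence `x`. -/
def seqProb {A : Type*} [Inhabited A] (k n : ℕ) (s0 : Fin k → A)
    (p : (Fin k → A) → A → ℝ) (x : Fin n → A) : ℝ :=
  ∏ t : Fin n, p (ctx k n s0 x t) (x t)

/-- `p` is a (strictly positive) `k`-th order Markov kernel. -/
def IsMarkov {A : Type*} [Fintype A] (k : ℕ) (p : (Fin k → A) → A → ℝ) : Prop :=
  (∀ s a, 0 < p s a) ∧ ∀ s, ∑ a : A, p s a = 1

/-- `n_{sa}(x)`: number of occurrences of symbol `a` in state `s`. -/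
def transCount {A : Type*} [Inhabited A] [DecidableEq A] (k n : ℕ) (s0 : Fin k → A)
    (s : Fin k → A) (a : A) (x : Fin n → A) : ℕ :=
  (Finset.univ.filter (fun t : Fin n => ctx k n s0 x t = s ∧ x t = a)).card

/-- The type class of `x` with respect to the class of `k`-th order processes. -/
def typeClass {A : Type*} [Fintype A] [Inhabited A] [DecidableEq A] (k n : ℕ)
    (s0 : Fin k → A) (x : Fin n → A) : Finset (Fin n → A) :=
  Finset.univ.filter (fun y => ∀ s a, transCount k n s0 s a y = transCount k n s0 s a x)

/-- The FVR `(S, Rf, Mf)` is perfect for the process `p`: conditioned on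
`Mf(X^n) = M0` (whenever this event has positive probability), the output
`Rf(X^n)` is uniformly distributed on `{0, …, M0 - 1}`. -/
def PerfectFVR {A : Type*} [Fintype A] [Inhabited A] [DecidableEq A] (k n : ℕ)
    (s0 : Fin k → A) (p : (Fin k → A) → A → ℝ) (S : Set ℕ)
    (Mf Rf : (Fin n → A) → ℕ) : Prop :=
  ∀ M0 ∈ S,
    (0 < ∑ x ∈ Finset.univ.filter (fun x : Fin n → A => Mf x = M0), seqProb k n s0 p x) →
    ∀ r < M0,
      (∑ x ∈ Finset.univ.filter (fun x : Fin n → A => Mf x = M0 ∧ Rf x = r),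
          seqProb k n s0 p x)
        = (∑ x ∈ Finset.univ.filter (fun x : Fin n → A => Mf x = M0),
            seqProb k n s0 p x) / (M0 : ℝ)

/-- The probability of a sequence depends only on its transition counts. -/
theorem seqProb_eq_prod_pow_transCount {A : Type*} [Fintype A] [Inhabited A] [DecidableEq A]
    (k n : ℕ) (s0 : Fin k → A) (p : (Fin k → A) → A → ℝ) (x : Fin n → A) :
    seqProb k n s0 p x =
      ∏ sa : (Fin k → A) × A, p sa.1 sa.2 ^ transCount k n s0 sa.1 sa.2 x := by
  unfold seqProb transCount
  rw [← Finset.prod_fiberwise_of_maps_to (t := Finset.univ)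
    (g := fun t : Fin n => (ctx k n s0 x t, x t)) (fun _ _ => Finset.mem_univ _)]
  refine Finset.prod_congr rfl fun sa _ => ?_
  rw [← Finset.prod_const]
  refine Finset.prod_congr (Finset.filter_congr fun t _ => Prod.ext_iff) fun t ht => ?_
  rw [← (Finset.mem_filter.mp ht).2.1, ← (Finset.mem_filter.mp ht).2.2]

/-- All sequences of a type class are equiprobable. -/
theorem seqProb_eq_of_mem_typeClass {A : Type*} [Fintype A] [Inhabited A] [DecidableEq A]
    (k n : ℕ) (s0 : Fin k → A) (p : (Fin k → A) → A → ℝ) {x y : Fin n → A}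
    (h : y ∈ typeClass k n s0 x) : seqProb k n s0 p y = seqProb k n s0 p x := by
  simp only [typeClass, Finset.mem_filter, Finset.mem_univ, true_and] at h
  simp only [seqProb_eq_prod_pow_transCount, h]

/-- Two events that meet every type class in equally many sequences are equiprobable. -/
theorem sum_seqProb_eq_of_card_typeClass_filter_eq {A : Type*} [Fintype A] [Inhabited A]
    [DecidableEq A] (k n : ℕ) (s0 : Fin k → A) (p : (Fin k → A) → A → ℝ)
    (P Q : (Fin n → A) → Prop) [DecidablePred P] [DecidablePred Q]
    (h : ∀ x, ((typeClass k n s0 x).filter P).card = ((typeClass k n s0 x).filter Q).card) :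
    ∑ x ∈ Finset.univ.filter P, seqProb k n s0 p x =
      ∑ x ∈ Finset.univ.filter Q, seqProb k n s0 p x := by
  classical
  have fiberwise : ∀ (R : (Fin n → A) → Prop) [DecidablePred R],
      ∑ x ∈ Finset.univ.filter R, seqProb k n s0 p x =
        ∑ T ∈ Finset.univ.image (typeClass k n s0),
          ∑ x ∈ (Finset.univ.filter R).filter (fun x => typeClass k n s0 x = T),
            seqProb k n s0 p x := fun R _ =>
    (Finset.sum_fiberwise_of_maps_to
      (fun x _ => Finset.mem_image_of_mem _ (Finset.mem_univ x)) _).symm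
  have mem_iff : ∀ x y : Fin n → A,
      typeClass k n s0 y = typeClass k n s0 x ↔ y ∈ typeClass k n s0 x := by
    intro x y
    constructor
    · intro hxy
      rw [← hxy]
      simp [typeClass]
    · intro hy
      simp only [typeClass, Finset.mem_filter, Finset.mem_univ, true_and] at hy
      simp only [typeClass, hy]
  have on_class : ∀ (R : (Fin n → A) → Prop) [DecidablePred R] (x : Fin n → A),
      ∑ y ∈ (Finset.univ.filter R).filter (fun y => typeClass k n s0 y = typeClass k n s0 x),
          seqProb k n s0 p y =
        ((typeClass k n s0 x).filter R).card * seqProb k n s0 p x := by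
    intro R _ x
    have hset : (Finset.univ.filter R).filter
        (fun y => typeClass k n s0 y = typeClass k n s0 x) = (typeClass k n s0 x).filter R := by
      ext y
      simp [mem_iff, and_comm]
    rw [hset, Finset.sum_congr rfl fun y hy =>
      seqProb_eq_of_mem_typeClass k n s0 p (Finset.mem_filter.mp hy).1]
    simp
  rw [fiberwise P, fiberwise Q]
  refine Finset.sum_congr rfl fun T hT => ?_
  obtain ⟨x, -, rfl⟩ := Finset.mem_image.mp hT
  rw [on_class P, on_class Q, h]

/-- If within every type class and for every `M0 ∈ S` the number of
sequences mapped to `(M0, r)` is the same for every `r < M0`, then the FVR is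
universal in `P_k`, i.e. perfect for every `k`-th order finite-memory process. -/
theorem fvr_balance_implies_universal {A : Type*} [Fintype A] [DecidableEq A] [Inhabited A]
    (hA : 2 ≤ Fintype.card A) (k n : ℕ) (s0 : Fin k → A)
    (S : Set ℕ) (hSpos : ∀ m ∈ S, 0 < m) (hS1 : 1 ∈ S)
    (Mf Rf : (Fin n → A) → ℕ)
    (hMS : ∀ x, Mf x ∈ S) (hRM : ∀ x, Rf x < Mf x)
    (hbal : ∀ (x0 : Fin n → A), ∀ M0 ∈ S, ∀ r < M0, ∀ r' < M0,
      ((typeClass k n s0 x0).filter (fun x => Mf x = M0 ∧ Rf x = r)).card =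
      ((typeClass k n s0 x0).filter (fun x => Mf x = M0 ∧ Rf x = r')).card) :
    ∀ p : (Fin k → A) → A → ℝ, IsMarkov k p → PerfectFVR k n s0 p S Mf Rf := by
  intro p _ M0 hM0 _ r hr
  have hne : (M0 : ℝ) ≠ 0 := by exact_mod_cast (hSpos M0 hM0).ne'
  rw [eq_div_iff hne, ← Finset.sum_fiberwise_of_maps_to (t := Finset.range M0) (g := Rf)
    (s := Finset.univ.filter (fun x : Fin n → A => Mf x = M0))
    (fun x hx => by
      rw [Finset.mem_range, ← (Finset.mem_filter.mp hx).2]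
      exact hRM x)]
  have hsum : ∀ r' ∈ Finset.range M0,
      ∑ x ∈ (Finset.univ.filter (fun x : Fin n → A => Mf x = M0)).filter (fun x => Rf x = r'),
          seqProb k n s0 p x =
        ∑ x ∈ Finset.univ.filter (fun x : Fin n → A => Mf x = M0 ∧ Rf x = r),
          seqProb k n s0 p x := by
    intro r' hr'
    rw [Finset.filter_filter]
    exact sum_seqProb_eq_of_card_typeClass_filter_eq k n s0 p _ _ fun x =>
      hbal x M0 hM0 r' (Finset.mem_range.mp hr') r hr
  rw [Finset.sum_congr rfl hsum, Finset.sum_const, Finset.card_range, nsmul_eq_mul, mul_comm]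
end

section
/- There exists a subset Π0 of the parameter domain Π, of Lebesgue measure zero and depending only on A, k and n (not on the FVR), with the following property: if an FVR F = (S, R, M) with input length n does not satisfy the balance condition — namely, there exist a type class T ∈ T_n, a value M0 ∈ S, and r, r' ∈ {0,…,M0−1} such that |{x^n ∈ T : M(x^n)=M0, R(x^n)=r}| ≠ |{x^n ∈ T : M(x^n)=M0, R(x^n)=r'}| — then F is perfect only for processes P whose parameter vector lies in Π0. -/
open Finset

/-- The Markov kernel determined by the free-parameter vector `θ` (the conditional
probabilities `p(a|s)` for `a ≠ b`); the probability of `b` given `s` is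
`1 - ∑_{a ≠ b} θ(s, a)`. -/
def toKernel {A : Type*} [Fintype A] [DecidableEq A] (k : ℕ) (b : A)
    (θ : ((Fin k → A) × {a : A // a ≠ b}) → ℝ) : (Fin k → A) → A → ℝ :=
  fun s a => if h : a = b then 1 - ∑ a' : {a : A // a ≠ b}, θ (s, a') else θ (s, ⟨a, h⟩)

section NullSet

open MeasureTheory

theorem MvPolynomial.volume_zeros_fin : ∀ (n : ℕ) (p : MvPolynomial (Fin n) ℝ), p ≠ 0 →
    volume {x : Fin n → ℝ | MvPolynomial.eval x p = 0} = 0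
  | 0, p, hp => by
    rw [MvPolynomial.eq_C_of_isEmpty p] at hp ⊢
    have hc : MvPolynomial.coeff 0 p ≠ 0 := fun h => hp (by rw [h, map_zero])
    simp [hc]
  | n + 1, p, hp => by
    set q := MvPolynomial.finSuccEquiv ℝ n p with hq
    have hq0 : q ≠ 0 := by
      simpa [hq] using hp
    have hlead := MvPolynomial.volume_zeros_fin n q.leadingCoeff
      (Polynomial.leadingCoeff_ne_zero.mpr hq0)
    have hcont : Continuous fun x : Fin (n + 1) → ℝ => MvPolynomial.eval x p :=
      MvPolynomial.continuous_eval p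
    have hmeas : MeasurableSet {x : Fin (n + 1) → ℝ | MvPolynomial.eval x p = 0} :=
      (isClosed_eq hcont continuous_const).measurableSet
    have hpres : MeasurePreserving
        (fun z : (Fin n → ℝ) × ℝ =>
          (MeasurableEquiv.piFinSuccAbove (fun _ : Fin (n + 1) => ℝ) 0).symm z.swap)
        (volume.prod volume) volume :=
      ((volume_preserving_piFinSuccAbove (fun _ : Fin (n + 1) => ℝ) 0).symm).comp
        Measure.measurePreserving_swap
    rw [← hpres.measure_preimage hmeas.nullMeasurableSet,
      Measure.measure_prod_null (hpres.measurable hmeas)]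
    have hae : ∀ᵐ y : Fin n → ℝ, MvPolynomial.eval y q.leadingCoeff ≠ 0 := by
      rw [ae_iff]
      simpa using hlead
    filter_upwards [hae] with y hy
    have hmap : q.map (MvPolynomial.eval y) ≠ 0 := fun h => hy (by
      have := congrArg (fun r => Polynomial.coeff r q.natDegree) h
      simpa [Polynomial.coeff_map] using this)
    refine Set.Finite.measure_zero ?_ _
    refine ((q.map (MvPolynomial.eval y)).roots.toFinset.finite_toSet).subset fun t ht => ?_
    have ht' : MvPolynomial.eval (Fin.cons t y : Fin (n + 1) → ℝ) p = 0 := by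
      simpa [MeasurableEquiv.piFinSuccAbove, Fin.insertNthEquiv] using ht
    rw [MvPolynomial.eval_eq_eval_mv_eval'] at ht'
    simp only [Finset.mem_coe, Multiset.mem_toFinset]
    exact (Polynomial.mem_roots hmap).mpr ht'

/-- The zero set of a nonzero real polynomial in finitely many variables is Lebesgue-null. -/
theorem MvPolynomial.volume_zeros {ι : Type*} [Fintype ι] (p : MvPolynomial ι ℝ) (hp : p ≠ 0) :
    volume {x : ι → ℝ | MvPolynomial.eval x p = 0} = 0 := by
  have e := Fintype.equivFin ι
  have hren : MvPolynomial.rename e p ≠ 0 := fun h =>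
    hp (MvPolynomial.rename_injective e e.injective (by rw [h, map_zero]))
  have h := MvPolynomial.volume_zeros_fin _ _ hren
  have hpres := volume_measurePreserving_piCongrLeft (fun _ : Fin (Fintype.card ι) => ℝ) e
  rw [← hpres.measure_preimage_equiv] at h
  convert! h using 2
  ext x
  simp only [Set.mem_ofPred_eq, Set.mem_preimage, MvPolynomial.eval_rename]
  have : (MeasurableEquiv.piCongrLeft (fun _ : Fin (Fintype.card ι) => ℝ) e x) ∘ e = x := by
    ext i
    exact Equiv.piCongrLeft_apply_apply (fun _ : Fin (Fintype.card ι) => ℝ) e x i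
  rw [this]

end NullSet

section SpanningCycle

open Equiv.Perm

/-- A permutation supported on a connected relation in which any two points with a common
successor have all their successors in common can be chosen to be a single cycle. -/
theorem exists_isCycleOn_univ_of_connected {V : Type*} [Fintype V] (R : V → V → Prop)
    (hrect : ∀ s s' t u, R s t → R s' t → R s u → R s' u)
    (hperm : ∃ σ : Equiv.Perm V, ∀ s, R s (σ s)) (v : V)
    (hconn : ∀ C : Set V, v ∈ C → (∀ s ∈ C, ∀ t, R s t → t ∈ C) → C = Set.univ) :
    ∃ σ : Equiv.Perm V, (∀ s, R s (σ s)) ∧ σ.IsCycleOn Set.univ := by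
  classical
  obtain ⟨σ, hσ, hmax⟩ := Finset.exists_max_image
    (Finset.univ.filter fun σ : Equiv.Perm V => ∀ s, R s (σ s))
    (fun σ => (Finset.univ.filter fun x => SameCycle σ v x).card)
    (by obtain ⟨σ, h⟩ := hperm; exact ⟨σ, by simpa using h⟩)
  simp only [Finset.mem_filter, Finset.mem_univ, true_and] at hσ hmax
  refine ⟨σ, hσ, ?_⟩
  suffices h : {x | SameCycle σ v x} = Set.univ by
    have h' : ∀ x, SameCycle σ v x := fun x => by
      have : x ∈ {x | SameCycle σ v x} := h ▸ Set.mem_univ x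
      exact this
    exact ⟨Set.bijOn_univ.mpr σ.bijective, fun x _ y _ => (h' x).symm.trans (h' y)⟩
  refine hconn _ SameCycle.rfl ?_
  by_contra! hcon
  obtain ⟨s, hs, t, hst, ht⟩ := hcon
  simp only [Set.mem_ofPred_eq] at hs ht
  set s' := σ.symm t with hs'
  have hσs' : σ s' = t := by simp [hs']
  have hs'C : ¬ SameCycle σ v s' := fun h => ht (by
    rw [← hσs']; exact sameCycle_apply_right.mpr h)
  set τ := σ * Equiv.swap s s' with hτ
  have hτs : τ s = t := by simp [hτ, hσs']
  have hτs' : τ s' = σ s := by simp [hτ]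
  have hτx : ∀ x, x ≠ s → x ≠ s' → τ x = σ x := fun x h h' => by
    simp [hτ, Equiv.swap_apply_of_ne_of_ne h h']
  have hRτ : ∀ x, R x (τ x) := by
    intro x
    by_cases h : x = s
    · subst h; rw [hτs]; exact hst
    by_cases h' : x = s'
    · rw [h', hτs']
      exact hrect s s' t _ hst (hσs' ▸ hσ s') (hσ s)
    · rw [hτx x h h']; exact hσ x
  have horbit : ∀ (j : ℕ) (x : V), SameCycle σ v x → (σ ^ j) x = s → SameCycle τ x s := by
    intro j
    induction j with
    | zero => rintro x - rfl; exact SameCycle.rfl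
    | succ j ih =>
      intro x hx hj
      by_cases h : x = s
      · exact h ▸ SameCycle.rfl
      have h' : x ≠ s' := fun h' => hs'C (h' ▸ hx)
      have := ih (σ x) (sameCycle_apply_right.mpr hx) (by
        rw [pow_succ] at hj; exact hj)
      rw [← hτx x h h'] at this
      exact sameCycle_apply_left.mp this
  have hto : ∀ x, SameCycle σ v x → SameCycle τ x s := fun x hx => by
    obtain ⟨j, hj⟩ := (hx.symm.trans hs).exists_nat_pow_eq
    exact horbit j x hx hj
  have hlt := Finset.card_lt_card (s := Finset.univ.filter fun x => SameCycle σ v x)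
    (t := Finset.univ.filter fun x => SameCycle τ v x) (by
      rw [Finset.ssubset_iff_of_subset]
      · refine ⟨t, ?_, by simpa using ht⟩
        simp only [Finset.mem_filter, Finset.mem_univ, true_and]
        rw [← hτs]
        exact sameCycle_apply_right.mpr (hto v SameCycle.rfl)
      · intro x hx
        simp only [Finset.mem_filter, Finset.mem_univ, true_and] at hx ⊢
        exact (hto v SameCycle.rfl).trans (hto x hx).symm)
  exact absurd (hmax τ hRτ) (not_le.mpr hlt)

/-- An integer flow of total mass zero along a spanning cycle, with at most one source and one
sink, vanishes. -/
theorem flow_eq_zero_of_isCycleOn {V : Type*} [Fintype V] (σ : Equiv.Perm V)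
    (hσ : σ.IsCycleOn Set.univ) (h : V → ℤ) (hsum : ∑ s, h s = 0) (f f' : V)
    (hflow : ∀ g : V → ℤ, ∑ s, h s * (g (σ s) - g s) = g f - g f') : h = 0 := by
  classical
  have hσ' : σ.IsCycleOn ((Finset.univ : Finset V) : Set V) := by simpa using hσ
  have hsame : ∀ x, ∃ j : ℤ, (σ ^ j) f = x := fun x => hσ.2 (Set.mem_univ _) (Set.mem_univ _)
  choose φ hφ using hsame
  have hstep : ∀ s, (Fintype.card V : ℤ) ∣ φ (σ s) - φ s - 1 := by
    intro s
    have h1 : (σ ^ (φ s + 1)) f = (σ ^ φ (σ s)) f := by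
      rw [hφ, add_comm, zpow_add, Equiv.Perm.mul_apply, hφ, zpow_one]
    have := ((hσ'.zpow_apply_eq_zpow_apply (Finset.mem_univ f)).mp h1).dvd
    rwa [Finset.card_univ, ← sub_sub] at this
  have hdvd : (Fintype.card V : ℤ) ∣ φ f - φ f' := by
    rw [← hflow φ]
    have : ∑ s, h s * (φ (σ s) - φ s) = ∑ s, h s * (φ (σ s) - φ s - 1) := by
      simp only [mul_sub, mul_one, Finset.sum_sub_distrib, hsum, sub_zero]
    rw [this]
    exact Finset.dvd_sum fun s _ => (hstep s).mul_left _
  have hff : f = f' := by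
    rw [← hφ f, ← hφ f']
    refine (hσ'.zpow_apply_eq_zpow_apply (Finset.mem_univ f)).mpr ?_
    rw [Finset.card_univ]
    exact (Int.modEq_iff_dvd.mpr hdvd).symm
  have hconst : ∀ s, h (σ s) = h s := by
    intro s
    have := hflow (fun u => if u = σ s then 1 else 0)
    simp only [hff, sub_self, mul_sub, Finset.sum_sub_distrib, σ.injective.eq_iff, mul_ite,
      mul_one, mul_zero, Finset.sum_ite_eq', Finset.mem_univ, if_true] at this
    omega
  have hpow : ∀ (j : ℕ), h ((σ ^ j) f) = h f := by
    intro j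
    induction j with
    | zero => rfl
    | succ j ih => rw [pow_succ', Equiv.Perm.mul_apply, hconst, ih]
  have hall : ∀ x, h x = h f := fun x => by
    obtain ⟨j, rfl⟩ := SameCycle.exists_nat_pow_eq (hσ.2 (Set.mem_univ f) (Set.mem_univ x))
    exact hpow j
  have hcard : (Fintype.card V : ℤ) * h f = 0 := by
    rw [← hsum, Finset.sum_congr rfl fun x _ => hall x]
    simp
  have : h f = 0 := by
    rcases mul_eq_zero.mp hcard with h0 | h0
    · exact absurd (Int.natCast_eq_zero.mp h0) ((Fintype.card_pos_iff.mpr ⟨f⟩).ne')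
    · exact h0
  ext x
  rw [hall x, this, Pi.zero_apply]

end SpanningCycle

/-- The state reached from `s` when the symbol `a` is emitted. -/
def nextState {A : Type*} {k : ℕ} (s : Fin k → A) (a : A) : Fin k → A :=
  fun i => if h : (i : ℕ) + 1 < k then s ⟨i + 1, h⟩ else a

/-- The de Bruijn graph has a Hamiltonian cycle. -/
theorem exists_hamiltonian_nextState (A : Type*) [Fintype A] [Inhabited A] (k : ℕ) :
    ∃ (σ : Equiv.Perm (Fin k → A)) (β : (Fin k → A) → A),
      (∀ s, nextState s (β s) = σ s) ∧ σ.IsCycleOn Set.univ := by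
  classical
  suffices h : ∃ σ : Equiv.Perm (Fin k → A),
      (∀ s, ∃ a, nextState s a = σ s) ∧ σ.IsCycleOn Set.univ by
    obtain ⟨σ, h, hc⟩ := h
    choose β hβ using h
    exact ⟨σ, β, hβ, hc⟩
  refine exists_isCycleOn_univ_of_connected (fun s t => ∃ a, nextState s a = t) ?_ ?_
    (fun _ => default) ?_
  · rintro s s' t u ⟨a, rfl⟩ ⟨a', h⟩ ⟨a'', rfl⟩
    refine ⟨a'', funext fun i => ?_⟩
    have := congrFun h i
    simp only [nextState] at this ⊢
    split_ifs with hi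
    · simpa [hi] using this
    · rfl
  · refine ⟨(finRotate k).symm.arrowCongr (Equiv.refl A), fun s => ?_⟩
    cases k with
    | zero => exact ⟨default, Subsingleton.elim _ _⟩
    | succ k =>
      refine ⟨s 0, funext fun i => ?_⟩
      simp only [nextState, Equiv.arrowCongr_apply, Equiv.symm_symm, Equiv.coe_refl,
        Function.comp_apply, id]
      split_ifs with hi
      · rw [← finRotate_of_lt (by omega : (i : ℕ) < k)]
      · have : i = Fin.last k := by ext; simp; omega
        rw [this, finRotate_last]
  · intro C hv hC
    refine Set.eq_univ_of_forall fun t => ?_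
    let w : ℕ → Fin k → A := fun j i =>
      if h : k ≤ i + j ∧ i + j - k < k then t ⟨i + j - k, h.2⟩ else default
    have hw : ∀ j ≤ k, w j ∈ C := by
      intro j
      induction j with
      | zero =>
        intro _
        convert hv using 1
        funext i
        simp only [w]
        rw [dif_neg (by omega)]
      | succ j ih =>
        intro hj
        refine hC _ (ih (by omega)) _ ⟨t ⟨j, by omega⟩, funext fun i => ?_⟩
        simp only [nextState, w]
        by_cases hi : (i : ℕ) + 1 < k
        · simp only [hi, dif_pos, show (i : ℕ) + 1 + j = i + (j + 1) by omega]
        · rw [dif_neg hi, dif_pos (by omega)]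
          congr 2
          omega
    convert hw k le_rfl using 1
    funext i
    simp only [w]
    rw [dif_pos (by omega)]
    congr 1
    ext
    simp

theorem exists_sum_ctx_telescope {A : Type*} [Inhabited A] {k n : ℕ} {s0 : Fin k → A}
    (x : Fin n → A) : ∃ f : Fin k → A, ∀ g : (Fin k → A) → ℤ,
    ∑ t, (g (nextState (ctx k n s0 x t) (x t)) - g (ctx k n s0 x t)) = g f - g s0 := by
  let w : ℕ → Fin k → A := fun j i => symAt k n s0 x ((j : ℤ) - k + i)
  refine ⟨w n, fun g => ?_⟩
  have h0 : w 0 = s0 := by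
    funext i
    simp only [w, symAt]
    rw [dif_neg (by omega), dif_pos (by omega)]
    congr 1
    ext
    simp
  have hstep : ∀ t : Fin n, nextState (ctx k n s0 x t) (x t) = w (t + 1) := by
    intro t
    funext i
    simp only [nextState, ctx, w]
    split_ifs with hi
    · congr 1
      push_cast
      ring
    · have hk : (((t : ℕ) + 1 : ℕ) : ℤ) - k + i = (t : ℕ) := by omega
      rw [hk]
      simp [symAt]
  calc _ = ∑ t : Fin n, (g (w (t + 1)) - g (w t)) :=
        Finset.sum_congr rfl fun t _ => by rw [hstep]; rfl
    _ = ∑ j ∈ Finset.range n, (g (w (j + 1)) - g (w j)) :=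
        (Finset.sum_range fun j => g (w (j + 1)) - g (w j)).symm
    _ = g (w n) - g s0 := by rw [Finset.sum_range_sub (fun j => g (w j)), h0]

section Types

variable {A : Type*} [Fintype A] [Inhabited A] [DecidableEq A] {k n : ℕ} {s0 : Fin k → A}

@[to_additive]
theorem prod_ctx_eq_prod_pow_transCount {G : Type*} [CommMonoid G] (F : (Fin k → A) → A → G)
    (x : Fin n → A) :
    ∏ t, F (ctx k n s0 x t) (x t) = ∏ s, ∏ a, F s a ^ transCount k n s0 s a x := by
  rw [← Finset.prod_fiberwise Finset.univ (fun t => (ctx k n s0 x t, x t)),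
    Fintype.prod_prod_type]
  refine Finset.prod_congr rfl fun s _ => Finset.prod_congr rfl fun a _ => ?_
  rw [transCount, ← Finset.prod_const]
  refine Finset.prod_congr (by ext; simp [Prod.ext_iff]) fun t ht => ?_
  simp only [Finset.mem_filter, Finset.mem_univ, true_and] at ht
  rw [ht.1, ht.2]

/-- The type of a sequence is determined by its transition counts off a Hamiltonian cycle of the
de Bruijn graph. -/
theorem transCount_eq_of_eq_off_cycle (σ : Equiv.Perm (Fin k → A)) (β : (Fin k → A) → A)
    (hβ : ∀ s, nextState s (β s) = σ s) (hσ : σ.IsCycleOn Set.univ) (x y : Fin n → A)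
    (hxy : ∀ s a, a ≠ β s → transCount k n s0 s a x = transCount k n s0 s a y) (s : Fin k → A)
    (a : A) : transCount k n s0 s a x = transCount k n s0 s a y := by
  let h : (Fin k → A) → ℤ := fun s =>
    (transCount k n s0 s (β s) x : ℤ) - transCount k n s0 s (β s) y
  have hred : ∀ G : (Fin k → A) → A → ℤ,
      ∑ t, G (ctx k n s0 x t) (x t) - ∑ t, G (ctx k n s0 y t) (y t) =
        ∑ s, h s * G s (β s) := by
    intro G
    rw [sum_ctx_eq_sum_nsmul_transCount G x, sum_ctx_eq_sum_nsmul_transCount G y,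
      ← Finset.sum_sub_distrib]
    refine Finset.sum_congr rfl fun s _ => ?_
    rw [← Finset.sum_sub_distrib, Finset.sum_eq_single (β s)]
    · simp only [h, nsmul_eq_mul, sub_mul]
    · intro a _ ha
      rw [hxy s a ha, sub_self]
    · simp
  obtain ⟨f, hf⟩ := exists_sum_ctx_telescope (s0 := s0) x
  obtain ⟨f', hf'⟩ := exists_sum_ctx_telescope (s0 := s0) y
  have hzero : h = 0 := by
    refine flow_eq_zero_of_isCycleOn σ hσ h ?_ f f' fun g => ?_
    · have := hred fun _ _ => 1
      simpa using this.symm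
    · have := hred fun s a => g (nextState s a) - g s
      simp only [hβ] at this
      rw [← this, hf g, hf' g]
      ring
  by_cases ha : a = β s
  · subst ha
    have := congrFun hzero s
    simp only [h, Pi.zero_apply] at this
    omega
  · exact hxy s a ha

/-- A signed combination of sequence probabilities that does not cancel on some type class is
nonzero at some (signed) stochastic matrix. -/
theorem exists_sum_seqProb_ne_zero (d : (Fin n → A) → ℤ) (x0 : Fin n → A)
    (hd : ∑ x ∈ typeClass k n s0 x0, d x ≠ 0) :
    ∃ q : (Fin k → A) → A → ℝ, (∀ s, ∑ a, q s a = 1) ∧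
      ∑ x, (d x : ℝ) * seqProb k n s0 q x ≠ 0 := by
  obtain ⟨σ, β, hβ, hσ⟩ := exists_hamiltonian_nextState A k
  let e : (Fin k → A) → A → ((Fin k → A) × A →₀ ℕ) := fun s a =>
    if a = β s then 0 else Finsupp.single (s, a) 1
  let B : (Fin k → A) → A → MvPolynomial ((Fin k → A) × A) ℝ := fun s a =>
    if a = β s then 1 - ∑ a' ∈ Finset.univ.erase (β s), MvPolynomial.X (s, a') else 1
  let Q : (Fin k → A) → A → MvPolynomial ((Fin k → A) × A) ℝ := fun s a =>
    MvPolynomial.monomial (e s a) 1 * B s a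
  have hQsum : ∀ s, ∑ a, Q s a = 1 := by
    intro s
    rw [← Finset.add_sum_erase _ _ (Finset.mem_univ (β s))]
    have h1 : Q s (β s) = 1 - ∑ a' ∈ Finset.univ.erase (β s), MvPolynomial.X (s, a') := by
      simp [Q, e, B]
    have h2 : ∑ a ∈ Finset.univ.erase (β s), Q s a =
        ∑ a' ∈ Finset.univ.erase (β s), MvPolynomial.X (s, a') := by
      refine Finset.sum_congr rfl fun a ha => ?_
      have ha' := Finset.ne_of_mem_erase ha
      simp [Q, e, B, ha', MvPolynomial.X]
    rw [h1, h2, sub_add_cancel]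
  let m : (Fin n → A) → ((Fin k → A) × A →₀ ℕ) := fun x => ∑ t, e (ctx k n s0 x t) (x t)
  let C : (Fin n → A) → MvPolynomial ((Fin k → A) × A) ℝ := fun x =>
    ∏ t, B (ctx k n s0 x t) (x t)
  have hm : ∀ x s a, a ≠ β s → m x (s, a) = transCount k n s0 s a x := by
    intro x s a ha
    simp only [m, Finsupp.finsetSum_apply, transCount, Finset.card_filter]
    refine Finset.sum_congr rfl fun t _ => ?_
    simp only [e]
    split_ifs with h1 h2 h2
    · exact absurd (h2.2 ▸ h2.1 ▸ h1) ha
    · rfl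
    · rw [h2.1, h2.2, Finsupp.single_eq_same]
    · rw [Finsupp.single_apply, if_neg (by simpa [Prod.ext_iff] using h2)]
  have htype : ∀ x y, m x = m y → ∀ s a, transCount k n s0 s a x = transCount k n s0 s a y :=
    fun x y hxy => transCount_eq_of_eq_off_cycle σ β hβ hσ x y fun s a ha => by
      rw [← hm x s a ha, ← hm y s a ha, hxy]
  have hmtype : ∀ x y, (∀ s a, transCount k n s0 s a x = transCount k n s0 s a y) →
      m x = m y := fun x y hxy => by
    simp only [m, sum_ctx_eq_sum_nsmul_transCount, hxy]
  have hC : ∀ x y, m x = m y → C x = C y := fun x y hxy => by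
    simp only [C, prod_ctx_eq_prod_pow_transCount, htype x y hxy]
  have hC0 : ∀ x, MvPolynomial.coeff 0 (C x) = 1 := by
    intro x
    rw [← MvPolynomial.constantCoeff_eq, map_prod]
    refine Finset.prod_eq_one fun t _ => ?_
    simp only [B]
    split_ifs <;> simp
  have hprod : ∀ x, ∏ t, Q (ctx k n s0 x t) (x t) = MvPolynomial.monomial (m x) 1 * C x := by
    intro x
    simp only [Q, Finset.prod_mul_distrib, C, m, MvPolynomial.monomial_sum_one]
  let D : ((Fin k → A) × A →₀ ℕ) → ℤ := fun μ => ∑ x with m x = μ, d x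
  have hD0 : D (m x0) ≠ 0 := by
    convert hd using 2
    ext y
    simp only [typeClass, Finset.mem_filter, Finset.mem_univ, true_and]
    exact ⟨htype y x0, hmtype y x0⟩
  obtain ⟨μ, hμ, hmin⟩ := WellFounded.has_min
    (wellFounded_lt : WellFounded (α := (Fin k → A) × A →₀ ℕ) (· < ·)) {μ | D μ ≠ 0} ⟨m x0, hD0⟩
  let P : MvPolynomial ((Fin k → A) × A) ℝ :=
    ∑ x, MvPolynomial.C (d x : ℝ) * ∏ t, Q (ctx k n s0 x t) (x t)
  have hP : MvPolynomial.coeff μ P = D μ := by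
    have hcoeff : MvPolynomial.coeff μ P =
        ∑ x, (d x : ℝ) * if m x ≤ μ then MvPolynomial.coeff (μ - m x) (C x) else 0 := by
      simp only [P, MvPolynomial.coeff_sum, MvPolynomial.coeff_C_mul, hprod,
        MvPolynomial.coeff_monomial_mul', one_mul]
    rw [hcoeff, ← Finset.sum_fiberwise_of_maps_to
      (fun x _ => Finset.mem_insert_of_mem (Finset.mem_image_of_mem m (Finset.mem_univ x)) :
        ∀ x ∈ Finset.univ, m x ∈ insert μ (Finset.univ.image m)),
      Finset.sum_eq_single μ]
    · simp only [D, Int.cast_sum]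
      refine Finset.sum_congr rfl fun x hx => ?_
      rw [(Finset.mem_filter.mp hx).2]
      simp [hC0]
    · intro ν hν hne
      obtain ⟨y, -, rfl⟩ := Finset.mem_image.mp (Finset.mem_of_mem_insert_of_ne hν hne)
      by_cases hle : m y ≤ μ
      · have hDy : D (m y) = 0 := by
          by_contra h
          exact hmin _ h (lt_of_le_of_ne hle hne)
        have : ∑ x with m x = m y,
            (d x : ℝ) * (if m x ≤ μ then MvPolynomial.coeff (μ - m x) (C x) else 0) =
            (D (m y) : ℝ) * MvPolynomial.coeff (μ - m y) (C y) := by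
          simp only [D, Int.cast_sum, Finset.sum_mul]
          refine Finset.sum_congr rfl fun x hx => ?_
          have hx' := (Finset.mem_filter.mp hx).2
          rw [hx', if_pos hle, hC x y hx']
        rw [this, hDy, Int.cast_zero, zero_mul]
      · refine Finset.sum_eq_zero fun x hx => ?_
        rw [(Finset.mem_filter.mp hx).2, if_neg hle, mul_zero]
    · intro h
      exact absurd (Finset.mem_insert_self _ _) h
  have hPne : P ≠ 0 := fun h => hμ (by
    have : (D μ : ℝ) = 0 := by rw [← hP, h, MvPolynomial.coeff_zero]
    exact_mod_cast this)
  obtain ⟨y, hy⟩ : ∃ y, MvPolynomial.eval y P ≠ 0 := by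
    by_contra! h
    exact hPne (MvPolynomial.funext fun y => by rw [h y, map_zero])
  refine ⟨fun s a => MvPolynomial.eval y (Q s a), fun s => ?_, ?_⟩
  · rw [← map_sum, hQsum, map_one]
  · simpa [P, seqProb, map_sum, map_prod] using hy

theorem volume_sum_seqProb_toKernel_eq_zero (b : A) (d : (Fin n → A) → ℤ) (x0 : Fin n → A)
    (hd : ∑ x ∈ typeClass k n s0 x0, d x ≠ 0) :
    MeasureTheory.volume {θ : ((Fin k → A) × {a : A // a ≠ b}) → ℝ |
      ∑ x, (d x : ℝ) * seqProb k n s0 (toKernel k b θ) x = 0} = 0 := by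
  let K : (Fin k → A) → A → MvPolynomial ((Fin k → A) × {a : A // a ≠ b}) ℝ := fun s a =>
    if h : a = b then 1 - ∑ a' : {a : A // a ≠ b}, MvPolynomial.X (s, a')
    else MvPolynomial.X (s, ⟨a, h⟩)
  have hK : ∀ θ s a, MvPolynomial.eval θ (K s a) = toKernel k b θ s a := by
    intro θ s a
    simp only [K, toKernel]
    split_ifs <;> simp
  let P := ∑ x, MvPolynomial.C (d x : ℝ) * ∏ t, K (ctx k n s0 x t) (x t)
  have hP : ∀ θ, MvPolynomial.eval θ P =
      ∑ x, (d x : ℝ) * seqProb k n s0 (toKernel k b θ) x := by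
    intro θ
    simp only [P, map_sum, map_mul, MvPolynomial.eval_C, map_prod, hK, seqProb]
  simp only [← hP]
  refine MvPolynomial.volume_zeros P fun h => ?_
  obtain ⟨q, hq, hne⟩ := exists_sum_seqProb_ne_zero d x0 hd
  have hker : toKernel k b (fun z => q z.1 z.2) = q := by
    funext s a
    simp only [toKernel]
    split_ifs with hab
    · subst hab
      rw [← hq s, ← Finset.add_sum_erase _ _ (Finset.mem_univ a),
        Finset.sum_subtype (p := fun a' => a' ≠ a) (Finset.univ.erase a) (by simp) (q s),
        add_sub_cancel_right]
    · rfl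
  apply hne
  rw [← hker, ← hP, h, map_zero]

end Types

/-- There is a Lebesgue-measure-zero subset `Π₀` of the parameter space,
depending only on `A`, `k` and `n`, such that any FVR violating the balance condition
can be perfect only for processes whose parameter vector lies in `Π₀`. -/
theorem fvr_unbalanced_perfect_only_on_null_set {A : Type*} [Fintype A] [DecidableEq A]
    [Inhabited A] (hA : 2 ≤ Fintype.card A) (k n : ℕ) (s0 : Fin k → A) (b : A) :
    ∃ Pi0 : Set (((Fin k → A) × {a : A // a ≠ b}) → ℝ),
      MeasureTheory.volume Pi0 = 0 ∧
      ∀ (S : Set ℕ), (∀ m ∈ S, 0 < m) → 1 ∈ S →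
      ∀ (Mf Rf : (Fin n → A) → ℕ), (∀ x, Mf x ∈ S) → (∀ x, Rf x < Mf x) →
      (∃ (x0 : Fin n → A), ∃ M0 ∈ S, ∃ r < M0, ∃ r' < M0,
        ((typeClass k n s0 x0).filter (fun x => Mf x = M0 ∧ Rf x = r)).card ≠
        ((typeClass k n s0 x0).filter (fun x => Mf x = M0 ∧ Rf x = r')).card) →
      ∀ θ : ((Fin k → A) × {a : A // a ≠ b}) → ℝ,
        (∀ s a, 0 < toKernel k b θ s a) →
        PerfectFVR k n s0 (toKernel k b θ) S Mf Rf → θ ∈ Pi0 := by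
  refine ⟨⋃ d ∈ {d : (Fin n → A) → ℤ | ∃ x0, ∑ x ∈ typeClass k n s0 x0, d x ≠ 0},
    {θ | ∑ x, (d x : ℝ) * seqProb k n s0 (toKernel k b θ) x = 0}, ?_, ?_⟩
  · refine (MeasureTheory.measure_biUnion_null_iff (Set.to_countable _)).mpr ?_
    rintro d ⟨x0, hd⟩
    exact volume_sum_seqProb_toKernel_eq_zero b d x0 hd
  · rintro S - - Mf Rf - - ⟨x0, M0, hM0, r, hr, r', hr', hne⟩ θ hθ hperf
    have hprob : ∀ x, 0 < seqProb k n s0 (toKernel k b θ) x := fun x =>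
      Finset.prod_pos fun t _ => hθ _ _
    have hpos : 0 < ∑ x ∈ Finset.univ.filter (fun x : Fin n → A => Mf x = M0),
        seqProb k n s0 (toKernel k b θ) x := by
      refine Finset.sum_pos (fun x _ => hprob x) ?_
      by_contra hempty
      have hM : ∀ x, Mf x ≠ M0 := by
        simpa [Finset.filter_eq_empty_iff] using hempty
      exact hne (by simp [hM])
    have heq := (hperf M0 hM0 hpos r hr).trans (hperf M0 hM0 hpos r' hr').symm
    let d : (Fin n → A) → ℤ := fun x =>
      (if Mf x = M0 ∧ Rf x = r then 1 else 0) - (if Mf x = M0 ∧ Rf x = r' then 1 else 0)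
    refine Set.mem_biUnion (x := d) ⟨x0, ?_⟩ ?_
    · simp only [d, Finset.sum_sub_distrib, Finset.sum_boole]
      exact sub_ne_zero.mpr (by exact_mod_cast hne)
    · simp only [Set.mem_ofPred_eq, d]
      push_cast
      simp only [sub_mul, ite_mul, one_mul, zero_mul, Finset.sum_sub_distrib,
        ← Finset.sum_filter]
      exact sub_eq_zero.mpr heq
end

section
/- Let q = (q_1, q_2, …, q_m) with q_1 ≥ q_2 ≥ ⋯ ≥ q_m > 0 be a probability vector (Σ_i q_i = 1) with Shannon entropy H = −Σ_{i=1}^m q_i log q_i. If for some constant c ≥ 1 it holds that c·q_i ≥ 1 − Σ_{j=1}^{i−1} q_j for every 1 ≤ i ≤ m, then H ≤ c·h(1/c), where h is the binary entropy function h(x) = −x log x − (1−x) log(1−x). -/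
open Finset

/-- Binary entropy function (base-2 logarithms), with `h(0) = h(1) = 0`
(note `Real.logb 2 0 = 0`). -/
noncomputable def binEnt (x : ℝ) : ℝ :=
  -(x * Real.logb 2 x + (1 - x) * Real.logb 2 (1 - x))

theorem binEnt_eq_binEntropy_div (x : ℝ) : binEnt x = Real.binEntropy x / Real.log 2 := by
  rw [binEnt, Real.binEntropy_eq_negMulLog_add_negMulLog_one_sub, Real.logb, Real.logb,
    Real.negMulLog, Real.negMulLog]
  ring

/-- The ratio `binEntropy p / p` is antitone on `(0, 1]`. -/
theorem mul_binEntropy_le_mul_binEntropy {a p : ℝ} (ha : 0 ≤ a) (hap : a ≤ p) (hp : p ≤ 1) :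
    a * Real.binEntropy p ≤ p * Real.binEntropy a := by
  rcases ha.eq_or_lt with rfl | ha
  · simp
  have hp0 : 0 < p := ha.trans_le hap
  have h0 : (0 : ℝ) ∈ Set.Icc (0 : ℝ) 1 := by simp
  have hpI : p ∈ Set.Icc (0 : ℝ) 1 := ⟨hp0.le, hp⟩
  have h := Real.strictConcave_binEntropy.concaveOn.2 h0 hpI
    (sub_nonneg.2 ((div_le_one hp0).2 hap)) (div_nonneg ha.le hp0.le) (sub_add_cancel 1 (a / p))
  simp only [smul_eq_mul, mul_zero, Real.binEntropy_zero, zero_add,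
    div_mul_cancel₀ a hp0.ne'] at h
  calc a * Real.binEntropy p = p * (a / p * Real.binEntropy p) := by field_simp
    _ ≤ p * Real.binEntropy a := by gcongr

/-- The grouping rule of entropy for splitting the mass `x + y` into `x` and `y`. -/
theorem negMulLog_add_negMulLog {x y : ℝ} (hx : 0 < x) (hy : 0 ≤ y) :
    Real.negMulLog x + Real.negMulLog y =
      (x + y) * Real.binEntropy (x / (x + y)) + Real.negMulLog (x + y) := by
  have hs : 0 < x + y := by positivity
  have h1 : 1 - x / (x + y) = y / (x + y) := by field_simp; ring
  rw [Real.binEntropy_eq_negMulLog_add_negMulLog_one_sub, h1]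
  rcases hy.eq_or_lt with rfl | hy
  · simp [hx.ne']
  simp only [Real.negMulLog, Real.log_div hx.ne' hs.ne', Real.log_div hy.ne' hs.ne']
  field_simp
  ring

/-- If every entry of a positive vector is at least a `1 / c` fraction of the tail it starts, then
its unnormalized entropy is controlled by the binary entropy of `1 / c`. -/
theorem sum_negMulLog_le_of_tail_le {c : ℝ} (hc : 1 ≤ c) :
    ∀ (m : ℕ) (q : Fin m → ℝ), (∀ i, 0 < q i) →
      (∀ i, ∑ j, q j - ∑ j ∈ Finset.univ.filter (fun j => j < i), q j ≤ c * q i) →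
      ∑ i, Real.negMulLog (q i) ≤
        c * Real.binEntropy (1 / c) * ∑ i, q i + Real.negMulLog (∑ i, q i)
  | 0, _, _, _ => by simp
  | m + 1, q, hpos, hcond => by
    have hc0 : 0 < c := by positivity
    have ih := sum_negMulLog_le_of_tail_le hc m (fun i => q i.succ) (fun i => hpos _) fun i => by
      have h := hcond i.succ
      rw [Finset.sum_filter, Fin.sum_univ_succ, Fin.sum_univ_succ] at h
      simp only [Fin.succ_lt_succ_iff, Fin.succ_pos, if_true] at h
      rw [Finset.sum_filter]
      linarith
    have h0 := hcond 0
    simp only [Fin.not_lt_zero, Finset.filter_false, Finset.sum_empty, sub_zero] at h0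
    rw [Fin.sum_univ_succ] at h0
    rw [Fin.sum_univ_succ, Fin.sum_univ_succ q]
    have ht : 0 ≤ ∑ i : Fin m, q i.succ := Finset.sum_nonneg fun i _ => (hpos _).le
    generalize ∑ i : Fin m, q i.succ = t at *
    have hx := hpos 0
    have hs : 0 < q 0 + t := by positivity
    have hsplit := negMulLog_add_negMulLog hx ht
    have hbin := mul_binEntropy_le_mul_binEntropy (a := 1 / c) (p := q 0 / (q 0 + t))
      (by positivity) (by rw [div_le_div_iff₀ hc0 hs]; linarith)
      ((div_le_one hs).2 (by linarith))
    have hle : (q 0 + t) * Real.binEntropy (q 0 / (q 0 + t)) ≤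
        c * Real.binEntropy (1 / c) * q 0 := by
      calc (q 0 + t) * Real.binEntropy (q 0 / (q 0 + t))
          = c * (q 0 + t) * (1 / c * Real.binEntropy (q 0 / (q 0 + t))) := by field_simp
        _ ≤ c * (q 0 + t) * (q 0 / (q 0 + t) * Real.binEntropy (1 / c)) := by gcongr
        _ = c * Real.binEntropy (1 / c) * q 0 := by field_simp
    linarith

/-- If `q_1 ≥ q_2 ≥ ⋯ ≥ q_m > 0` is a probability vector such that
`c·q_i ≥ 1 − Σ_{j<i} q_j` for all `i` (for some `c ≥ 1`), then its Shannon entropy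
satisfies `H ≤ c·h(1/c)`. -/
theorem entropy_le_of_greedy_tail_condition (m : ℕ) (hm : 0 < m) (q : Fin m → ℝ)
    (hpos : ∀ i, 0 < q i) (hmono : ∀ i j : Fin m, i ≤ j → q j ≤ q i)
    (hsum : ∑ i, q i = 1)
    (c : ℝ) (hc : 1 ≤ c)
    (hcond : ∀ i : Fin m,
      1 - ∑ j ∈ Finset.univ.filter (fun j => j < i), q j ≤ c * q i) :
    (-∑ i, q i * Real.logb 2 (q i)) ≤ c * binEnt (1 / c) := by
  have h := sum_negMulLog_le_of_tail_le hc m q hpos (by simpa only [hsum] using hcond)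
  rw [hsum, Real.negMulLog_one, mul_one, add_zero] at h
  have hH : -∑ i, q i * Real.logb 2 (q i) = (∑ i, Real.negMulLog (q i)) / Real.log 2 := by
    rw [← Finset.sum_neg_distrib, Finset.sum_div]
    refine Finset.sum_congr rfl fun i _ => ?_
    rw [Real.negMulLog, Real.logb]
    ring
  rw [hH, binEnt_eq_binEntropy_div, ← mul_div_assoc]
  gcongr
end

section
/- Let F^tu = (S, R^tu, M^tu) be the twice-universal FVR obtained by applying Procedure E2 with the classes U(x^n) in place of type classes, where the Markov order is estimated by the penalized maximum-likelihood estimator k(·). Then for every true order k ≥ 0 and every P ∈ P_k, the distance to uniformity satisfies D(F^tu) ≤ 2·P_under(n), where P_under(n) = P(k(X^n) < k) is the underestimation probability. -/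
open Finset

/-- Symbol at (0-indexed) integer position `j` of `x : Fin n → A`, where negative
positions are given by the fixed semi-infinite initial string `s0inf`
(position `-(i+1)` carries the symbol `s0inf i`). -/
def symInf {A : Type*} [Inhabited A] (n : ℕ) (s0inf : ℕ → A) (x : Fin n → A) (j : ℤ) : A :=
  if h : 0 ≤ j then
    (if h2 : j.toNat < n then x ⟨j.toNat, h2⟩ else default)
  else s0inf (-(j + 1)).toNat

/-- The order-`j` context preceding position `t` of `x`. -/
def ctxInf {A : Type*} [Inhabited A] (j n : ℕ) (s0inf : ℕ → A) (x : Fin n → A)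
    (t : Fin n) : Fin j → A :=
  fun i => symInf n s0inf x ((t : ℤ) - (j : ℤ) + (i : ℤ))

/-- `n_{sa}^{(j)}(x)`: order-`j` transition counts. -/
def countInf {A : Type*} [Inhabited A] [DecidableEq A] (j n : ℕ) (s0inf : ℕ → A)
    (s : Fin j → A) (a : A) (x : Fin n → A) : ℕ :=
  (Finset.univ.filter (fun t : Fin n => ctxInf j n s0inf x t = s ∧ x t = a)).card

/-- Order-`j` empirical conditional entropy `Ĥ_j(x)` (base-2 logarithms; the
conventions `0·log 0 = 0` and `0/0 = 0` are automatic). -/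
noncomputable def empEnt {A : Type*} [Fintype A] [Inhabited A] [DecidableEq A]
    (j n : ℕ) (s0inf : ℕ → A) (x : Fin n → A) : ℝ :=
  -(1 / (n : ℝ)) * ∑ s : Fin j → A, ∑ a : A,
    (countInf j n s0inf s a x : ℝ) *
      Real.logb 2 ((countInf j n s0inf s a x : ℝ) /
        (∑ a' : A, (countInf j n s0inf s a' x : ℝ)))

/-- The penalized cost `Ĥ_j(x) + α^j φ(n)` minimized by the order estimator. -/
noncomputable def estCost {A : Type*} [Fintype A] [Inhabited A] [DecidableEq A]
    (j n : ℕ) (s0inf : ℕ → A) (φ : ℝ) (x : Fin n → A) : ℝ :=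
  empEnt j n s0inf x + (Fintype.card A : ℝ) ^ j * φ

/-- The class `U(x)`: sequences estimating the same order as `x` and belonging to
the same type class of that estimated order. -/
def tuClass {A : Type*} [Fintype A] [Inhabited A] [DecidableEq A] (n : ℕ)
    (s0inf : ℕ → A) (kest : (Fin n → A) → ℕ) (x : Fin n → A) : Finset (Fin n → A) :=
  Finset.univ.filter (fun y =>
    kest y = kest x ∧
    ∀ (s : Fin (kest x) → A) (a : A),
      countInf (kest x) n s0inf s a y = countInf (kest x) n s0inf s a x)

/-- Probability of `x` under the `k`-th order process `p` (initial states from `s0inf`). -/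
noncomputable def seqProbInf {A : Type*} [Inhabited A] (k n : ℕ) (s0inf : ℕ → A)
    (p : (Fin k → A) → A → ℝ) (x : Fin n → A) : ℝ :=
  ∏ t : Fin n, p (ctxInf k n s0inf x t) (x t)

/-- `g(M) = max { j ∈ S : j ≤ M }`. -/
noncomputable def gmax (S : Set ℕ) (M : ℕ) : ℕ :=
  @Nat.findGreatest (· ∈ S) (Classical.decPred _) M

/-- The greedy decomposition step of Procedure E2. -/
noncomputable def e2 (S : Set ℕ) : ℕ → ℕ → ℕ × ℕ
  | r, idx =>
    if h : 0 < gmax S r ∧ gmax S r ≤ idx then e2 S (r - gmax S r) (idx - gmax S r)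
    else (gmax S r, idx)
  termination_by r idx => idx
  decreasing_by exact Nat.sub_lt (Nat.lt_of_lt_of_le h.1 h.2) h.1

/-- Inside the range `i < N`, Procedure E2 places `i` in a block `[b, b + m)` contained in
`[0, N)`, on which it returns the block length and the offset. -/
theorem e2_block {S : Set ℕ} (hS1 : 1 ∈ S) (i N : ℕ) (hi : i < N) :
    ∃ b, i = b + (e2 S N i).2 ∧ (e2 S N i).2 < (e2 S N i).1 ∧ b + (e2 S N i).1 ≤ N ∧
      ∀ r < (e2 S N i).1, e2 S N (b + r) = ((e2 S N i).1, r) := by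
  induction i using Nat.strong_induction_on generalizing N with
  | _ i ih =>
    have hpos : 0 < gmax S N := by
      classical
      unfold gmax
      exact Nat.findGreatest_pos.2 ⟨1, one_pos, by omega, hS1⟩
    have hle : gmax S N ≤ N := by
      classical
      unfold gmax
      exact Nat.findGreatest_le N
    by_cases h : gmax S N ≤ i
    · have he : e2 S N i = e2 S (N - gmax S N) (i - gmax S N) := by
        conv_lhs => rw [e2, dif_pos ⟨hpos, h⟩]
      obtain ⟨b, h1, h2, h3, h4⟩ := ih (i - gmax S N) (by omega) (N - gmax S N) (by omega)
      rw [he]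
      refine ⟨b + gmax S N, by omega, h2, by omega, fun r hr => ?_⟩
      rw [e2, dif_pos ⟨hpos, by omega⟩, ← h4 r hr]
      congr 1
      omega
    · have he : ∀ j < gmax S N, e2 S N j = (gmax S N, j) := fun j hj => by
        rw [e2, dif_neg (by omega)]
      rw [he i (by omega)]
      exact ⟨0, by simp, by simpa using h, by simpa using hle,
        fun r hr => by rw [zero_add, he r hr]⟩

/-- Under a process of order `k ≤ j`, the order-`j` counts determine the sequence probability. -/
theorem seqProbInf_eq_of_countInf_eq {A : Type*} [Fintype A] [DecidableEq A] [Inhabited A]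
    {k j n : ℕ} (hkj : k ≤ j) (s0inf : ℕ → A) (p : (Fin k → A) → A → ℝ) {x y : Fin n → A}
    (h : ∀ s a, countInf j n s0inf s a y = countInf j n s0inf s a x) :
    seqProbInf k n s0inf p y = seqProbInf k n s0inf p x := by
  have key : ∀ z : Fin n → A, seqProbInf k n s0inf p z =
      ∏ b : (Fin j → A) × A,
        p (fun i : Fin k => b.1 ⟨i + (j - k), by omega⟩) b.2 ^ countInf j n s0inf b.1 b.2 z := by
    intro z
    have hctx : ∀ t : Fin n, ctxInf k n s0inf z t =
        fun i : Fin k => ctxInf j n s0inf z t ⟨i + (j - k), by omega⟩ := by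
      intro t
      funext i
      unfold ctxInf
      congr 1
      push_cast [Nat.cast_sub hkj]
      ring
    unfold seqProbInf
    simp_rw [hctx]
    rw [← Finset.prod_fiberwise' Finset.univ (fun t => (ctxInf j n s0inf z t, z t))
      (fun b : (Fin j → A) × A => p (fun i : Fin k => b.1 ⟨i + (j - k), by omega⟩) b.2)]
    refine Finset.prod_congr rfl fun b _ => ?_
    rw [Finset.prod_const, countInf]
    simp only [Prod.ext_iff]
  rw [key, key]
  exact Finset.prod_congr rfl fun b _ => by rw [h]

theorem tuClass_eq_of_mem {A : Type*} [Fintype A] [Inhabited A] [DecidableEq A] {n : ℕ}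
    {s0inf : ℕ → A} {kest : (Fin n → A) → ℕ} {x y : Fin n → A}
    (h : y ∈ tuClass n s0inf kest x) : tuClass n s0inf kest y = tuClass n s0inf kest x := by
  simp only [tuClass, Finset.mem_filter, Finset.mem_univ, true_and] at h
  obtain ⟨hk, hc⟩ := h
  have hcounts : ∀ (z : Fin n → A) (m : ℕ), m = kest x →
      ((∀ (s : Fin m → A) a, countInf m n s0inf s a z = countInf m n s0inf s a y) ↔
        ∀ (s : Fin (kest x) → A) a,
          countInf (kest x) n s0inf s a z = countInf (kest x) n s0inf s a x) := by
    rintro z _ rfl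
    exact forall₂_congr fun s a => by rw [hc]
  ext z
  simp only [tuClass, Finset.mem_filter, Finset.mem_univ, true_and]
  rw [hcounts z _ hk, hk]

theorem mem_tuClass_self {A : Type*} [Fintype A] [Inhabited A] [DecidableEq A] {n : ℕ}
    {s0inf : ℕ → A} {kest : (Fin n → A) → ℕ} (x : Fin n → A) : x ∈ tuClass n s0inf kest x := by
  simp [tuClass]

/-- An injective enumeration of each class attains every index below the size of the class. -/
theorem exists_mem_tuClass_enum_eq {A : Type*} [Fintype A] [Inhabited A] [DecidableEq A] {n : ℕ}
    {s0inf : ℕ → A} {kest enum : (Fin n → A) → ℕ}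
    (henum1 : ∀ x, enum x < (tuClass n s0inf kest x).card)
    (henum2 : ∀ x y, y ∈ tuClass n s0inf kest x → enum y = enum x → y = x)
    (x : Fin n → A) {i : ℕ} (hi : i < (tuClass n s0inf kest x).card) :
    ∃ y ∈ tuClass n s0inf kest x, enum y = i := by
  have hmaps : Set.MapsTo enum (tuClass n s0inf kest x)
      (Finset.range (tuClass n s0inf kest x).card) := by
    intro y hy
    have := henum1 y
    rw [tuClass_eq_of_mem hy] at this
    simpa using this
  have hinj : Set.InjOn enum (tuClass n s0inf kest x) := fun y hy z hz hyz =>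
    henum2 z y (by rw [tuClass_eq_of_mem hz]; exact hy) hyz
  have := Finset.surjOn_of_injOn_of_card_le enum hmaps hinj (by simp)
  exact this (by simpa using hi)

/-- A simulator whose outputs `f x = (M, R)` are uniform in `R` when restricted to the
complement of a `bad` event is within `2 P(bad)` of uniformity. -/
theorem distance_to_uniformity_le {X : Type*} [Fintype X] (f : X → ℕ × ℕ)
    (hf : ∀ x, (f x).2 < (f x).1) (w : X → ℝ) (hw : ∀ x, 0 ≤ w x) (bad : X → Prop)
    [DecidablePred bad]
    (hgood : ∀ M, ∀ r < M, ∀ r' < M,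
      ∑ x with ((f x).1 = M ∧ (f x).2 = r) ∧ ¬ bad x, w x =
        ∑ x with ((f x).1 = M ∧ (f x).2 = r') ∧ ¬ bad x, w x) :
    ∑ M ∈ Finset.univ.image (fun x => (f x).1), (1 / (M : ℝ)) *
        ∑ r ∈ Finset.range M, ∑ r' ∈ Finset.range M,
          |∑ x with (f x).1 = M ∧ (f x).2 = r, w x -
            ∑ x with (f x).1 = M ∧ (f x).2 = r', w x|
      ≤ 2 * ∑ x with bad x, w x := by
  set q : ℕ → ℕ → ℝ := fun M r => ∑ x with ((f x).1 = M ∧ (f x).2 = r) ∧ bad x, w x with hq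
  have hq0 : ∀ M r, 0 ≤ q M r := fun M r => Finset.sum_nonneg fun x _ => hw x
  have hsplit : ∀ M r, ∑ x with (f x).1 = M ∧ (f x).2 = r, w x =
      q M r + ∑ x with ((f x).1 = M ∧ (f x).2 = r) ∧ ¬ bad x, w x := by
    intro M r
    rw [hq, ← Finset.sum_filter_add_sum_filter_not _ bad, Finset.filter_filter,
      Finset.filter_filter]
  have hfib : ∀ M, ∑ r ∈ Finset.range M, q M r = ∑ x with bad x ∧ (f x).1 = M, w x := by
    intro M
    rw [← Finset.sum_fiberwise_of_maps_to (g := fun x => (f x).2) (t := Finset.range M)]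
    · refine Finset.sum_congr rfl fun r _ => ?_
      rw [hq, Finset.filter_filter]
      refine Finset.sum_congr (Finset.filter_congr fun x _ => ?_) fun _ _ => rfl
      tauto
    · intro x hx
      have := hf x
      rw [(Finset.mem_filter.1 hx).2.2] at this
      simpa using this
  have hM : ∀ M ∈ Finset.univ.image (fun x => (f x).1), (1 / (M : ℝ)) *
      ∑ r ∈ Finset.range M, ∑ r' ∈ Finset.range M,
        |∑ x with (f x).1 = M ∧ (f x).2 = r, w x -
          ∑ x with (f x).1 = M ∧ (f x).2 = r', w x| ≤
      2 * ∑ x with bad x ∧ (f x).1 = M, w x := by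
    intro M hMi
    obtain ⟨x, -, rfl⟩ := Finset.mem_image.1 hMi
    set M := (f x).1
    have hMpos : (0 : ℝ) < M := by exact_mod_cast (Nat.zero_le _).trans_lt (hf x)
    have hbound : ∑ r ∈ Finset.range M, ∑ r' ∈ Finset.range M,
        |∑ x with (f x).1 = M ∧ (f x).2 = r, w x -
          ∑ x with (f x).1 = M ∧ (f x).2 = r', w x| ≤
        ∑ r ∈ Finset.range M, ∑ r' ∈ Finset.range M, (q M r + q M r') := by
      refine Finset.sum_le_sum fun r hr => Finset.sum_le_sum fun r' hr' => ?_
      rw [hsplit, hsplit,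
        hgood M r (Finset.mem_range.1 hr) r' (Finset.mem_range.1 hr'), add_sub_add_right_eq_sub,
        abs_le]
      constructor <;> linarith [hq0 M r, hq0 M r']
    have hval : ∑ r ∈ Finset.range M, ∑ r' ∈ Finset.range M, (q M r + q M r') =
        M * (2 * ∑ x with bad x ∧ (f x).1 = M, w x) := by
      simp only [Finset.sum_add_distrib, Finset.sum_const, Finset.card_range, nsmul_eq_mul,
        ← Finset.mul_sum, hfib]
      ring
    rw [hval] at hbound
    rw [one_div, inv_mul_le_iff₀ hMpos]
    exact hbound
  refine (Finset.sum_le_sum hM).trans_eq ?_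
  rw [← Finset.mul_sum, ← Finset.sum_fiberwise_of_maps_to (s := Finset.univ.filter bad)
    (g := fun x => (f x).1) (t := Finset.univ.image (fun x => (f x).1))
    (fun x _ => Finset.mem_image_of_mem _ (Finset.mem_univ x))]
  simp only [Finset.filter_filter]

/-- The twice-universal FVR `F^tu` (Procedure E2 applied to the
classes `U(x^n)` induced by the penalized ML order estimator `kest`) satisfies
`D(F^tu) ≤ 2·P_under(n)` for every true order `k` and every `P ∈ P_k`. -/
theorem twice_universal_distance_to_uniformity {A : Type*} [Fintype A] [DecidableEq A]
    [Inhabited A] (hA : 2 ≤ Fintype.card A) (n : ℕ) (s0inf : ℕ → A)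
    (S : Set ℕ) (hSpos : ∀ m ∈ S, 0 < m) (hS1 : 1 ∈ S)
    (c : ℝ) (hc : 1 ≤ c)
    (hdense : ∀ M : ℕ, 0 < M → (M : ℝ) ≤ c * (gmax S M : ℝ))
    (φ : ℝ) (hφ : 0 < φ)
    (kest : (Fin n → A) → ℕ)
    (hkmin : ∀ (x : Fin n → A) (j : ℕ),
      estCost (kest x) n s0inf φ x ≤ estCost j n s0inf φ x)
    (hktie : ∀ (x : Fin n → A) (j : ℕ),
      estCost j n s0inf φ x = estCost (kest x) n s0inf φ x → kest x ≤ j)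
    (enum : (Fin n → A) → ℕ)
    (henum1 : ∀ x, enum x < (tuClass n s0inf kest x).card)
    (henum2 : ∀ x y, y ∈ tuClass n s0inf kest x → enum y = enum x → y = x)
    (k : ℕ) (p : (Fin k → A) → A → ℝ) (hp : IsMarkov k p) :
    -- D(F^tu) ≤ 2 · P_under(n)
    (∑ M0 ∈ Finset.image
        (fun x : Fin n → A => (e2 S ((tuClass n s0inf kest x).card) (enum x)).1)
        Finset.univ,
      (1 / (M0 : ℝ)) *
        ∑ r ∈ Finset.range M0, ∑ r' ∈ Finset.range M0,
          |(∑ x ∈ Finset.univ.filter (fun x : Fin n → A =>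
                (e2 S ((tuClass n s0inf kest x).card) (enum x)).1 = M0 ∧
                (e2 S ((tuClass n s0inf kest x).card) (enum x)).2 = r),
              seqProbInf k n s0inf p x) -
            (∑ x ∈ Finset.univ.filter (fun x : Fin n → A =>
                (e2 S ((tuClass n s0inf kest x).card) (enum x)).1 = M0 ∧
                (e2 S ((tuClass n s0inf kest x).card) (enum x)).2 = r'),
              seqProbInf k n s0inf p x)|)
      ≤ 2 * ∑ x ∈ Finset.univ.filter (fun x : Fin n → A => kest x < k),
          seqProbInf k n s0inf p x := by
  set f : (Fin n → A) → ℕ × ℕ := fun x => e2 S (tuClass n s0inf kest x).card (enum x) with hf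
  have hmove : ∀ x, ∀ r' < (f x).1, ∃ y ∈ tuClass n s0inf kest x,
      enum y + (f x).2 = enum x + r' ∧ f y = ((f x).1, r') := by
    intro x r' hr'
    obtain ⟨b, h1, h2, h3, h4⟩ := e2_block hS1 _ _ (henum1 x)
    change enum x = b + (f x).2 at h1
    obtain ⟨y, hy, hyb⟩ := exists_mem_tuClass_enum_eq henum1 henum2 x
      (i := b + r') (by change b + (f x).1 ≤ _ at h3; omega)
    refine ⟨y, hy, by omega, ?_⟩
    change e2 S (tuClass n s0inf kest y).card (enum y) = _
    rw [tuClass_eq_of_mem hy, hyb]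
    exact h4 r' hr'
  refine distance_to_uniformity_le f (fun x => ?_) (seqProbInf k n s0inf p)
    (fun x => Finset.prod_nonneg fun t _ => (hp.1 _ _).le) (fun x => kest x < k) ?_
  · obtain ⟨_, -, h, -⟩ := e2_block hS1 _ _ (henum1 x)
    exact h
  intro M r hr r' hr'
  choose! g hg using hmove
  have hmem : ∀ {x y}, y ∈ tuClass n s0inf kest x → kest y = kest x := fun h =>
    (Finset.mem_filter.1 h).2.1
  refine Finset.sum_bij (fun x _ => g x r') ?_ ?_ ?_ ?_
  · intro x hx
    simp only [Finset.mem_filter, Finset.mem_univ, true_and] at hx ⊢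
    obtain ⟨⟨rfl, rfl⟩, hb⟩ := hx
    obtain ⟨h1, h2, h3⟩ := hg x r' hr'
    rw [h3, hmem h1]
    exact ⟨⟨rfl, rfl⟩, hb⟩
  · intro x hx z hz hxz
    simp only [Finset.mem_filter, Finset.mem_univ, true_and] at hx hz
    obtain ⟨h1, h2, -⟩ := hg x r' (by omega)
    obtain ⟨k1, k2, -⟩ := hg z r' (by omega)
    rw [hxz] at h1 h2
    refine henum2 z x ?_ (by omega)
    rw [← tuClass_eq_of_mem k1, tuClass_eq_of_mem h1]
    exact mem_tuClass_self x
  · intro y hy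
    simp only [Finset.mem_filter, Finset.mem_univ, true_and] at hy
    obtain ⟨h1, h2, h3⟩ := hg y r (by omega)
    have hM : (f (g y r)).1 = M := by rw [h3]; exact hy.1.1
    have hR : (f (g y r)).2 = r := by rw [h3]
    obtain ⟨k1, k2, -⟩ := hg (g y r) r' (by omega)
    refine ⟨g y r, ?_, henum2 y _ (tuClass_eq_of_mem h1 ▸ k1) (by omega)⟩
    simp only [Finset.mem_filter, Finset.mem_univ, true_and]
    exact ⟨⟨hM, hR⟩, by rw [hmem h1]; exact hy.2⟩
  · intro x hx
    simp only [Finset.mem_filter, Finset.mem_univ, true_and, not_lt] at hx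
    obtain ⟨h1, -, -⟩ := hg x r' (by omega)
    exact (seqProbInf_eq_of_countInf_eq hx.2 s0inf p (Finset.mem_filter.1 h1).2.2).symm
end
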